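/- arXiv:2510.19534 — 2 statements merged into one kernel-verified Lean document; each statement's English description precedes it below -/
import Mathlib

section
/- Let n ≥ 2, γ ∈ ℝ, and n < p < +∞. There exists a constant C > 0 such that: if ω : ℝⁿ₊ × ℝⁿ₊ → [0, +∞) is continuous and satisfies, for every u ∈ C_c^∞(ℝⁿ₊) and for all x, y ∈ ℝⁿ₊, the estimate |u(x) − u(y)| ≤ ω(x, y) · E_γ(u)^{1/p}, then for all x, y ∈ ℝⁿ₊ one has ω(x, y) ≥ C · Θ⁰_γ(x, y). -/
open MeasureTheory Real Set
open scoped ENNReal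

noncomputable section

/-- The last coordinate `xₙ` of a point of `ℝⁿ`. -/
def lastCoord (n : ℕ) (x : EuclideanSpace ℝ (Fin n)) : ℝ :=
  if h : 0 < n then x ⟨n - 1, Nat.sub_lt h one_pos⟩ else 0

/-- The open upper half-space `ℝⁿ₊`. -/
def upperHalf (n : ℕ) : Set (EuclideanSpace ℝ (Fin n)) :=
  {z | 0 < lastCoord n z}

/-- The weighted energy `E_γ(u) = ∫_{ℝⁿ₊} ‖Du(z)‖^p zₙ^γ dz`, as a value in `[0, +∞]`. -/
def energy (n : ℕ) (γ p : ℝ) (u : EuclideanSpace ℝ (Fin n) → ℝ) : ℝ≥0∞ :=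
  ∫⁻ z in upperHalf n, ENNReal.ofReal (‖fderiv ℝ u z‖ ^ p * lastCoord n z ^ γ)

/-- The function `Θ⁰_γ` from the weighted Morrey–Sobolev inequality for compactly supported
functions. -/
def Theta0 (n : ℕ) (γ p : ℝ) (x y : EuclideanSpace ℝ (Fin n)) : ℝ :=
  if p - n < γ then
    ‖x - y‖ ^ (1 - (n : ℝ) / p) /
      (min (lastCoord n x) (lastCoord n y) ^ (((n : ℝ) + γ) / p - 1) *
        max (max (lastCoord n x) (lastCoord n y)) ‖x - y‖ ^ (1 - (n : ℝ) / p))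
  else
    max (lastCoord n x) (lastCoord n y) ^ (1 - ((n : ℝ) + γ) / p) *
        ‖x - y‖ ^ (1 - (n : ℝ) / p) /
      max (max (lastCoord n x) (lastCoord n y)) ‖x - y‖ ^ (1 - (n : ℝ) / p)

theorem abs_lastCoord_sub_le (n : ℕ) (x y : EuclideanSpace ℝ (Fin n)) :
    |lastCoord n x - lastCoord n y| ≤ ‖x - y‖ := by
  unfold lastCoord
  split_ifs with h
  · simpa using PiLp.norm_apply_le (x - y) ⟨n - 1, Nat.sub_lt h one_pos⟩
  · simp

theorem measurableSet_upperHalf (n : ℕ) : MeasurableSet (upperHalf n) := by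
  have h : Continuous (lastCoord n) := by
    unfold lastCoord
    split_ifs with h
    · fun_prop
    · fun_prop
  exact (isOpen_lt continuous_const h).measurableSet

/-- A power of a number comparable to `h` is comparable to the power of `h`. -/
theorem rpow_le_two_rpow_abs_mul {t h : ℝ} (γ : ℝ) (hh : 0 < h) (h₁ : h / 2 ≤ t)
    (h₂ : t ≤ 2 * h) : t ^ γ ≤ 2 ^ |γ| * h ^ γ := by
  have ht : 0 < t := by linarith
  rcases le_total 0 γ with hγ | hγ
  · rw [abs_of_nonneg hγ, ← mul_rpow zero_le_two hh.le]
    exact rpow_le_rpow ht.le h₂ hγ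
  · calc t ^ γ ≤ (h / 2) ^ γ := rpow_le_rpow_of_nonpos (by positivity) h₁ hγ
      _ = 2 ^ |γ| * h ^ γ := by
        rw [abs_of_nonpos hγ, div_rpow hh.le zero_le_two, rpow_neg zero_le_two]
        field_simp

/-- A test function concentrated on a ball well inside the half-space, with an energy bound
of the natural scaling. -/
theorem exists_bump_energy_le (n : ℕ) (p γ : ℝ) (hp : 0 < p) :
    ∃ A : ℝ, 0 < A ∧ ∀ a ∈ upperHalf n, ∀ r : ℝ, 0 < r → r ≤ lastCoord n a / 2 →
      ∃ u : EuclideanSpace ℝ (Fin n) → ℝ, ContDiff ℝ (⊤ : ℕ∞) u ∧ HasCompactSupport u ∧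
        tsupport u ⊆ upperHalf n ∧ u a = 1 ∧ (∀ b, r ≤ ‖a - b‖ → u b = 0) ∧
        (energy n γ p u).toReal ≤ A * (r ^ ((n : ℝ) - p) * lastCoord n a ^ γ) := by
  let φ : ContDiffBump (0 : EuclideanSpace ℝ (Fin n)) := ⟨1 / 2, 1, by norm_num, by norm_num⟩
  have hφ : ContDiff ℝ (⊤ : ℕ∞) φ := φ.contDiff
  obtain ⟨K₀, hK₀⟩ := (φ.hasCompactSupport.fderiv (𝕜 := ℝ)).exists_bound_of_continuous
    (hφ.continuous_fderiv (by simp))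
  obtain ⟨K, hK, hKpos⟩ : ∃ K : ℝ, (∀ z, ‖fderiv ℝ φ z‖ ≤ K) ∧ 0 < K :=
    ⟨max K₀ 1, fun z => (hK₀ z).trans (le_max_left _ _), by positivity⟩
  set V : ℝ := (volume (Metric.closedBall (0 : EuclideanSpace ℝ (Fin n)) 1)).toReal
  have hV : 0 < V := ENNReal.toReal_pos
    (Metric.measure_closedBall_pos _ _ one_pos).ne' measure_closedBall_lt_top.ne
  refine ⟨K ^ p * 2 ^ |γ| * V, by positivity, fun a ha r hr hra => ?_⟩
  have ha' : 0 < lastCoord n a := ha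
  set u : EuclideanSpace ℝ (Fin n) → ℝ := fun z => φ (r⁻¹ • (z - a)) with hu
  have hball : ∀ z ∈ Metric.closedBall a r,
      lastCoord n a / 2 ≤ lastCoord n z ∧ lastCoord n z ≤ 2 * lastCoord n a := by
    intro z hz
    rw [mem_closedBall_iff_norm] at hz
    have := abs_le.1 ((abs_lastCoord_sub_le n z a).trans (hz.trans hra))
    constructor <;> linarith [this.1, this.2]
  have hzero : ∀ b, r ≤ ‖a - b‖ → u b = 0 := by
    intro b hb
    apply φ.zero_of_le_dist
    rw [dist_zero_right, norm_smul, norm_inv, Real.norm_of_nonneg hr.le, norm_sub_rev]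
    change 1 ≤ _
    rw [inv_mul_eq_div, one_le_div hr]
    exact hb
  have hsupp : tsupport u ⊆ Metric.closedBall a r := by
    refine closure_minimal (fun z hz => ?_) Metric.isClosed_closedBall
    by_contra hz'
    rw [mem_closedBall_iff_norm, not_le, norm_sub_rev] at hz'
    exact hz (hzero z hz'.le)
  have hderiv : ∀ z, ‖fderiv ℝ u z‖ ≤ r⁻¹ * K := by
    intro z
    have h₁ : HasFDerivAt (fun z : EuclideanSpace ℝ (Fin n) => r⁻¹ • (z - a))
        (r⁻¹ • ContinuousLinearMap.id ℝ _) z :=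
      ((hasFDerivAt_id z).sub_const a).const_smul r⁻¹
    have h₂ := ((hφ.differentiable (by simp)) (r⁻¹ • (z - a))).hasFDerivAt.comp z h₁
    have h₃ : fderiv ℝ u z = r⁻¹ • fderiv ℝ φ (r⁻¹ • (z - a)) := by
      rw [show u = φ ∘ fun z => r⁻¹ • (z - a) from rfl, h₂.fderiv]
      ext v
      simp
    rw [h₃, norm_smul, norm_inv, Real.norm_of_nonneg hr.le]
    exact mul_le_mul_of_nonneg_left (hK _) (by positivity)
  refine ⟨u, hφ.comp (by fun_prop), ?_, fun z hz => ?_, ?_, hzero, ?_⟩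
  · exact HasCompactSupport.of_support_subset_isCompact (isCompact_closedBall a r)
      (subset_closure.trans hsupp)
  · exact lt_of_lt_of_le (by positivity) (hball z (hsupp hz)).1
  · simp only [hu, sub_self, smul_zero]
    exact φ.one_of_mem_closedBall (Metric.mem_closedBall_self φ.rIn_pos.le)
  · set c : ℝ := (r⁻¹ * K) ^ p * (2 ^ |γ| * lastCoord n a ^ γ) with hc
    have hcpos : 0 ≤ c := by positivity
    have hE : energy n γ p u ≤ ENNReal.ofReal c * volume (Metric.closedBall a r) := by
      unfold energy
      calc _ ≤ ∫⁻ z in upperHalf n,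
              (Metric.closedBall a r).indicator (fun _ => ENNReal.ofReal c) z := by
            refine setLIntegral_mono' (measurableSet_upperHalf n) fun z hz => ?_
            by_cases hz' : z ∈ Metric.closedBall a r
            · rw [indicator_of_mem hz']
              refine ENNReal.ofReal_le_ofReal ?_
              have h₁ := rpow_le_two_rpow_abs_mul γ ha' (hball z hz').1 (hball z hz').2
              have h₂ := rpow_le_rpow (norm_nonneg _) (hderiv z) hp.le
              have hz₀ : 0 < lastCoord n z := hz
              exact mul_le_mul h₂ h₁ (by positivity) (by positivity)
            · have h₀ : fderiv ℝ u z = 0 :=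
                Function.notMem_support.1 fun h => hz' (hsupp (support_fderiv_subset ℝ h))
              simp [h₀, zero_rpow hp.ne']
        _ ≤ ∫⁻ z, (Metric.closedBall a r).indicator (fun _ => ENNReal.ofReal c) z :=
            setLIntegral_le_lintegral _ _
        _ = _ := by
            rw [lintegral_indicator Metric.isClosed_closedBall.measurableSet, setLIntegral_const]
    have hvol : (volume (Metric.closedBall a r)).toReal = r ^ n * V := by
      rw [Measure.addHaar_closedBall' volume a hr.le, ENNReal.toReal_mul,
        ENNReal.toReal_ofReal (by positivity)]
      simp [V]
    refine (ENNReal.toReal_mono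
      (ENNReal.mul_ne_top ENNReal.ofReal_ne_top measure_closedBall_lt_top.ne) hE).trans_eq ?_
    rw [ENNReal.toReal_mul, ENNReal.toReal_ofReal hcpos, hvol, hc,
      mul_rpow (by positivity) hKpos.le, inv_rpow hr.le, rpow_sub hr, rpow_natCast]
    ring

/-- The modulus controls, at two points, the natural scaling of a bump around one of them. -/
theorem exists_bump_lower_bound (n : ℕ) (p γ : ℝ) (hp : 0 < p) :
    ∃ B : ℝ, 0 < B ∧ ∀ a ∈ upperHalf n, ∀ b : EuclideanSpace ℝ (Fin n), ∀ r w : ℝ, 0 < r →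
      r ≤ lastCoord n a / 2 → r ≤ ‖a - b‖ → 0 ≤ w →
      (∀ u : EuclideanSpace ℝ (Fin n) → ℝ,
          ContDiff ℝ (⊤ : ℕ∞) u → HasCompactSupport u → tsupport u ⊆ upperHalf n →
            |u a - u b| ≤ w * (energy n γ p u).toReal ^ (1 / p)) →
      B * (r ^ (1 - (n : ℝ) / p) * lastCoord n a ^ (-(γ / p))) ≤ w := by
  obtain ⟨A, hA, H⟩ := exists_bump_energy_le n p γ hp
  refine ⟨A ^ (-(1 / p)), by positivity, fun a ha b r w hr hra hrb hw hyp => ?_⟩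
  obtain ⟨u, hu₁, hu₂, hu₃, hu₄, hu₅, hu₆⟩ := H a ha r hr hra
  have ha' : 0 < lastCoord n a := ha
  have h₁ := hyp u hu₁ hu₂ hu₃
  rw [hu₄, hu₅ b hrb, sub_zero, abs_one] at h₁
  have h₂ := h₁.trans (mul_le_mul_of_nonneg_left
    (rpow_le_rpow ENNReal.toReal_nonneg hu₆ (by positivity : 0 ≤ 1 / p)) hw)
  have h₃ : A ^ (-(1 / p)) * (r ^ (1 - (n : ℝ) / p) * lastCoord n a ^ (-(γ / p))) =
      ((A * (r ^ ((n : ℝ) - p) * lastCoord n a ^ γ)) ^ (1 / p))⁻¹ := by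
    rw [← rpow_neg (by positivity), mul_rpow hA.le (by positivity),
      mul_rpow (by positivity) (by positivity), ← rpow_mul hr.le, ← rpow_mul ha'.le]
    congr 3 <;> (field_simp; try ring_nf)
  rw [h₃]
  exact (inv_le_iff_one_le_mul₀ (by positivity)).2 h₂

theorem Theta0_comm (n : ℕ) (γ p : ℝ) (x y : EuclideanSpace ℝ (Fin n)) :
    Theta0 n γ p x y = Theta0 n γ p y x := by
  simp only [Theta0, norm_sub_rev x y, min_comm (lastCoord n x), max_comm (lastCoord n x)]

/-- `Θ⁰_γ` is dominated by the scaling of a bump around one of the two points. -/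
theorem Theta0_le_of_lastCoord_le (n : ℕ) (γ p : ℝ) (hp : 0 < p) (hnp : (n : ℝ) < p)
    {x y : EuclideanSpace ℝ (Fin n)} (hy : y ∈ upperHalf n)
    (hyx : lastCoord n y ≤ lastCoord n x) (hne : x ≠ y) :
    ∃ a r : ℝ, (a = lastCoord n x ∨ a = lastCoord n y) ∧ 0 < r ∧ r ≤ a / 2 ∧ r ≤ ‖x - y‖ ∧
      Theta0 n γ p x y ≤ 2 ^ (1 - (n : ℝ) / p + |((n : ℝ) + γ) / p - 1|) *
        (r ^ (1 - (n : ℝ) / p) * a ^ (-(γ / p))) := by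
  have hd : 0 < ‖x - y‖ := norm_pos_iff.2 (sub_ne_zero.2 hne)
  have hm : 0 < lastCoord n y := hy
  have hdist := (le_abs_self _).trans (abs_lastCoord_sub_le n x y)
  unfold Theta0
  rw [min_eq_right hyx, max_eq_left hyx]
  generalize ‖x - y‖ = d at *
  generalize lastCoord n y = m at *
  generalize lastCoord n x = M at *
  have hM : 0 < M := hm.trans_le hyx
  have hα : 0 < 1 - (n : ℝ) / p := by
    have := (div_lt_one hp).2 hnp
    linarith
  obtain ⟨α, hα'⟩ : ∃ α, α = 1 - (n : ℝ) / p := ⟨_, rfl⟩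
  obtain ⟨β, hβ'⟩ : ∃ β, β = ((n : ℝ) + γ) / p - 1 := ⟨_, rfl⟩
  have hγ : -(γ / p) = -α + -β := by rw [hα', hβ']; ring
  have hβ₂ : 1 - ((n : ℝ) + γ) / p = -β := by rw [hβ']; ring
  rw [hβ₂, ← hα', ← hβ', hγ]
  rw [← hα'] at hα
  have hhalf : ∀ h : ℝ, 0 < h →
      h ^ (-β) ≤ 2 ^ (α + |β|) * ((h / 2) ^ α * h ^ (-α + -β)) := by
    intro h hh
    have e : 2 ^ (α + |β|) * ((h / 2) ^ α * h ^ (-α + -β)) = 2 ^ |β| * h ^ (-β) := by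
      rw [rpow_add two_pos, div_rpow hh.le zero_le_two, rpow_add hh, rpow_neg hh.le α]
      field_simp
    rw [e]
    exact le_mul_of_one_le_left (by positivity)
      (one_le_rpow one_le_two (abs_nonneg β))
  have hmax : d ^ α ≤ max M d ^ α := rpow_le_rpow hd.le (le_max_right _ _) hα.le
  have hmaxpos : 0 < max M d := lt_max_of_lt_left hM
  have htwo : (1 : ℝ) ≤ 2 ^ α := one_le_rpow one_le_two hα.le
  rcases le_or_gt d (M / 2) with hdM | hdM
  · refine ⟨M, d, Or.inl rfl, hd, hdM, le_rfl, ?_⟩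
    have hmx : max M d = M := max_eq_left (by linarith)
    have hmM : m ^ (-β) ≤ 2 ^ |β| * M ^ (-β) := by
      have := rpow_le_two_rpow_abs_mul (t := m) (-β) hM (by linarith) (by linarith)
      rwa [abs_neg] at this
    have hMM : M ^ (-β) ≤ 2 ^ |β| * M ^ (-β) :=
      le_mul_of_one_le_left (by positivity) (one_le_rpow one_le_two (abs_nonneg β))
    have key : ∀ q, q ≤ 2 ^ |β| * M ^ (-β) →
        q * d ^ α / M ^ α ≤ 2 ^ (α + |β|) * (d ^ α * M ^ (-α + -β)) := by
      intro q hq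
      rw [rpow_add hM, rpow_neg hM.le α, rpow_add two_pos]
      calc q * d ^ α / M ^ α ≤ (2 ^ |β| * M ^ (-β)) * d ^ α / M ^ α := by gcongr
        _ ≤ 2 ^ α * ((2 ^ |β| * M ^ (-β)) * d ^ α / M ^ α) :=
          le_mul_of_one_le_left (by positivity) htwo
        _ = _ := by ring
    rw [hmx]
    split_ifs
    · convert key _ hmM using 1
      rw [rpow_neg hm.le]
      field_simp
    · exact key _ hMM
  · split_ifs
    · refine ⟨m, m / 2, Or.inr rfl, by positivity, le_rfl, by linarith, ?_⟩
      refine le_trans ?_ (hhalf m hm)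
      rw [div_mul_eq_div_div, rpow_neg hm.le, div_right_comm]
      exact (div_le_div_of_nonneg_right ((div_le_one (by positivity)).2 hmax)
        (by positivity)).trans_eq (one_div _)
    · refine ⟨M, M / 2, Or.inl rfl, by positivity, le_rfl, hdM.le, ?_⟩
      refine le_trans ?_ (hhalf M hM)
      rw [mul_div_assoc]
      exact mul_le_of_le_one_right (by positivity) ((div_le_one (by positivity)).2 hmax)

/-- Optimality of the weighted Morrey–Sobolev inequality for compactly supported functions. -/
theorem weighted_morrey_sobolev_optimal_compact (n : ℕ) (hn : 2 ≤ n) (p γ : ℝ)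
    (hnp : (n : ℝ) < p) :
    ∃ C : ℝ, 0 < C ∧
      ∀ ω : EuclideanSpace ℝ (Fin n) → EuclideanSpace ℝ (Fin n) → ℝ,
        ContinuousOn (fun q : EuclideanSpace ℝ (Fin n) × EuclideanSpace ℝ (Fin n) => ω q.1 q.2)
          (upperHalf n ×ˢ upperHalf n) →
        (∀ x ∈ upperHalf n, ∀ y ∈ upperHalf n, 0 ≤ ω x y) →
        (∀ u : EuclideanSpace ℝ (Fin n) → ℝ,
          ContDiff ℝ (⊤ : ℕ∞) u → HasCompactSupport u → tsupport u ⊆ upperHalf n →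
          ∀ x ∈ upperHalf n, ∀ y ∈ upperHalf n,
            |u x - u y| ≤ ω x y * (energy n γ p u).toReal ^ (1 / p)) →
        ∀ x ∈ upperHalf n, ∀ y ∈ upperHalf n, C * Theta0 n γ p x y ≤ ω x y := by
  have hp : 0 < p := lt_of_le_of_lt n.cast_nonneg hnp
  obtain ⟨B, hB, H⟩ := exists_bump_lower_bound n p γ hp
  obtain ⟨D, hD⟩ : ∃ D : ℝ, D = 2 ^ (1 - (n : ℝ) / p + |((n : ℝ) + γ) / p - 1|) := ⟨_, rfl⟩
  have hDpos : 0 < D := by rw [hD]; positivity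
  refine ⟨B / D, by positivity, fun ω _ hω hyp => ?_⟩
  have main : ∀ x ∈ upperHalf n, ∀ y ∈ upperHalf n, lastCoord n y ≤ lastCoord n x → ∀ w : ℝ,
      0 ≤ w → (∀ u : EuclideanSpace ℝ (Fin n) → ℝ,
          ContDiff ℝ (⊤ : ℕ∞) u → HasCompactSupport u → tsupport u ⊆ upperHalf n →
            |u x - u y| ≤ w * (energy n γ p u).toReal ^ (1 / p)) →
      B / D * Theta0 n γ p x y ≤ w := by
    intro x hx y hy hyx w hw hu
    rcases eq_or_ne x y with rfl | hne
    · have hα : 1 - (n : ℝ) / p ≠ 0 := (sub_pos.2 ((div_lt_one hp).2 hnp)).ne'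
      simpa [Theta0, zero_rpow hα] using hw
    obtain ⟨a, r, ha, hr, hra, hrd, hΘ⟩ := Theta0_le_of_lastCoord_le n γ p hp hnp hy hyx hne
    rw [← hD] at hΘ
    refine le_trans (b := B * (r ^ (1 - (n : ℝ) / p) * a ^ (-(γ / p)))) ?_ ?_
    · calc B / D * Theta0 n γ p x y
          ≤ B / D * (D * (r ^ (1 - (n : ℝ) / p) * a ^ (-(γ / p)))) := by gcongr
        _ = _ := by field_simp
    · rcases ha with rfl | rfl
      · exact H x hx y r w hr hra hrd hw hu
      · refine H y hy x r w hr hra (by rwa [norm_sub_rev]) hw fun u h₁ h₂ h₃ => ?_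
        rw [abs_sub_comm]
        exact hu u h₁ h₂ h₃
  intro x hx y hy
  rcases le_total (lastCoord n y) (lastCoord n x) with h | h
  · exact main x hx y hy h _ (hω x hx y hy) fun u h₁ h₂ h₃ => hyp u h₁ h₂ h₃ x hx y hy
  · rw [Theta0_comm]
    refine main y hy x hx h _ (hω x hx y hy) fun u h₁ h₂ h₃ => ?_
    rw [abs_sub_comm]
    exact hyp u h₁ h₂ h₃ x hx y hy
end
end

section
/- Let n ≥ 1 and n < p < +∞. There exists a constant C > 0, depending only on n and p, such that every function u : ℝⁿ → ℝ that is continuously differentiable on ℝⁿ₊ and satisfies ∫_{ℝⁿ₊} ‖Du(z)‖^p zₙ^{p−n} dz < +∞ also satisfies, for all x, y ∈ ℝⁿ₊, |u(x) − u(y)| ≤ C · max( d_ℍ(x,y)^{1 − n/p}, d_ℍ(x,y)^{1 − 1/p} ) · ( ∫_{ℝⁿ₊} ‖Du(z)‖^p zₙ^{p−n} dz )^{1/p}. -/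
open MeasureTheory Real Set
open scoped ENNReal

noncomputable section

/-- The hyperbolic distance on the Poincaré half-space model. -/
def hypDist (n : ℕ) (x y : EuclideanSpace ℝ (Fin n)) : ℝ :=
  2 * Real.arsinh (‖x - y‖ / (2 * Real.sqrt (lastCoord n x * lastCoord n y)))

/-- A pointwise comparison of a power weight with a logarithmic derivative. -/
lemma one_add_rpow_neg_mul_rpow_le {α s : ℝ} (hα : 0 < α) (hα1 : α ≤ 1) (hs : 0 < s) :
    (1 + s) ^ (-α) * s ^ (α - 1) ≤ (1 + s)⁻¹ * (1 + Real.log (1 + s) ^ (α - 1)) := by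
  have h1 : (0 : ℝ) < 1 + s := by linarith
  have hlog : 0 < Real.log (1 + s) := Real.log_pos (by linarith)
  have hle : Real.log (1 + s) ≤ s := by
    have := Real.log_le_sub_one_of_pos h1
    linarith
  have h2 : s ^ (α - 1) ≤ Real.log (1 + s) ^ (α - 1) :=
    Real.rpow_le_rpow_of_nonpos hlog hle (by linarith)
  have h3 : (1 + s) ^ (1 - α) ≤ 1 + s ^ (1 - α) := by
    simpa using Real.rpow_add_le_add_rpow zero_le_one hs.le
      (by linarith : 0 ≤ 1 - α) (by linarith)
  have h4 : (1 + s) ^ (-α) = (1 + s)⁻¹ * (1 + s) ^ (1 - α) := by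
    rw [← Real.rpow_neg_one, ← Real.rpow_add h1]
    congr 1
    ring
  have h5 : s ^ (1 - α) * s ^ (α - 1) = 1 := by
    rw [← Real.rpow_add hs]
    simp
  have h6 : 0 < s ^ (α - 1) := Real.rpow_pos_of_pos hs _
  rw [h4, mul_assoc]
  gcongr
  calc (1 + s) ^ (1 - α) * s ^ (α - 1) ≤ (1 + s ^ (1 - α)) * s ^ (α - 1) := by gcongr
    _ = s ^ (α - 1) + 1 := by rw [add_mul, h5, one_mul]
    _ ≤ 1 + Real.log (1 + s) ^ (α - 1) := by linarith

lemma lintegral_rpow_weight_le {α a h : ℝ} (hα : 0 < α) (hα1 : α ≤ 1) (ha : 0 < a) (hh : 0 < h) :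
    ∫⁻ t in Ioo (0 : ℝ) 1, ENNReal.ofReal ((a + t * h) ^ (-α) * t ^ (α - 1)) ≤
      ENNReal.ofReal
        (h ^ (-α) * (Real.log (1 + h / a) + Real.log (1 + h / a) ^ α / α)) := by
  set b := h / a with hb
  have hb0 : 0 < b := div_pos hh ha
  let F : ℝ → ℝ := fun t ↦ h ^ (-α) * (Real.log (1 + t * b) + Real.log (1 + t * b) ^ α / α)
  let F' : ℝ → ℝ := fun t ↦
    h ^ (-α) * (b * ((1 + t * b)⁻¹ * (1 + Real.log (1 + t * b) ^ (α - 1))))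
  have hderiv : ∀ t ∈ Ioo (0 : ℝ) 1, HasDerivAt F (F' t) t := by
    intro t ht
    have h1 : 0 < t * b := mul_pos ht.1 hb0
    have hl : 0 < Real.log (1 + t * b) := Real.log_pos (by linarith)
    have d0 : HasDerivAt (fun t : ℝ ↦ 1 + t * b) b t := by
      simpa using ((hasDerivAt_id t).mul_const b).const_add 1
    have d1 := d0.log (by linarith : 1 + t * b ≠ 0)
    have d2 := d1.rpow_const (p := α) (Or.inl hl.ne')
    refine ((d1.add (d2.div_const α)).const_mul (h ^ (-α))).congr_deriv ?_
    simp only [F']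
    field_simp
  have hF'0 : ∀ t ∈ Ioo (0 : ℝ) 1, 0 ≤ F' t := by
    intro t ht
    have h1 : 0 < t * b := mul_pos ht.1 hb0
    have hl : 0 < Real.log (1 + t * b) := Real.log_pos (by linarith)
    positivity
  have hcont : ContinuousOn F (Icc 0 1) := by
    have hl : ContinuousOn (fun t : ℝ ↦ Real.log (1 + t * b)) (Icc 0 1) := by
      refine ContinuousOn.log (by fun_prop) fun t ht ↦ ?_
      have : 0 ≤ t * b := mul_nonneg ht.1 hb0.le
      positivity
    exact continuousOn_const.mul
      (hl.add ((hl.rpow_const fun t _ ↦ Or.inr hα.le).div_const α))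
  have hint := intervalIntegral.integrableOn_deriv_of_nonneg hcont hderiv hF'0
  have hftc := intervalIntegral.integral_eq_sub_of_hasDerivAt_of_le zero_le_one hcont hderiv
    ((intervalIntegrable_iff_integrableOn_Ioc_of_le zero_le_one).2 hint)
  calc ∫⁻ t in Ioo (0 : ℝ) 1, ENNReal.ofReal ((a + t * h) ^ (-α) * t ^ (α - 1))
      ≤ ∫⁻ t in Ioo (0 : ℝ) 1, ENNReal.ofReal (F' t) := by
        refine setLIntegral_mono' measurableSet_Ioo fun t ht ↦ ENNReal.ofReal_le_ofReal ?_
        have hs : 0 < t * b := mul_pos ht.1 hb0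
        have e1 : a + t * h = h * (b⁻¹ * (1 + t * b)) := by
          simp only [hb]; field_simp
        have e2 : (a + t * h) ^ (-α) = h ^ (-α) * (b ^ α * (1 + t * b) ^ (-α)) := by
          rw [e1, Real.mul_rpow hh.le (by positivity), Real.mul_rpow (by positivity)
            (by positivity), Real.inv_rpow hb0.le, Real.rpow_neg hb0.le, inv_inv]
        have e3 : t ^ (α - 1) = b ^ (1 - α) * (t * b) ^ (α - 1) := by
          rw [Real.mul_rpow ht.1.le hb0.le, mul_left_comm, ← Real.rpow_add hb0]
          simp
        have e4 : b ^ α * b ^ (1 - α) = b := by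
          rw [← Real.rpow_add hb0]; simp
        calc (a + t * h) ^ (-α) * t ^ (α - 1)
            = h ^ (-α) * ((b ^ α * b ^ (1 - α)) *
                ((1 + t * b) ^ (-α) * (t * b) ^ (α - 1))) := by rw [e2, e3]; ring
          _ = h ^ (-α) * (b * ((1 + t * b) ^ (-α) * (t * b) ^ (α - 1))) := by rw [e4]
          _ ≤ F' t := by
            exact mul_le_mul_of_nonneg_left (mul_le_mul_of_nonneg_left
              (one_add_rpow_neg_mul_rpow_le hα hα1 hs) hb0.le) (Real.rpow_nonneg hh.le _)
    _ = ENNReal.ofReal (∫ t in Ioo (0 : ℝ) 1, F' t) := by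
        rw [ofReal_integral_eq_lintegral_ofReal (hint.mono_set Ioo_subset_Ioc_self)]
        exact (ae_restrict_iff' measurableSet_Ioo).2 (Filter.Eventually.of_forall hF'0)
    _ = ENNReal.ofReal (F 1 - F 0) := by
        rw [← hftc, intervalIntegral.integral_of_le zero_le_one, integral_Ioc_eq_integral_Ioo]
    _ = _ := by simp [F, hα.ne']

lemma lastCoord_sub (n : ℕ) (x y : EuclideanSpace ℝ (Fin n)) :
    lastCoord n (x - y) = lastCoord n x - lastCoord n y := by
  unfold lastCoord; split_ifs <;> simp

lemma lastCoord_add (n : ℕ) (x y : EuclideanSpace ℝ (Fin n)) :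
    lastCoord n (x + y) = lastCoord n x + lastCoord n y := by
  unfold lastCoord; split_ifs <;> simp

lemma lastCoord_smul (n : ℕ) (t : ℝ) (x : EuclideanSpace ℝ (Fin n)) :
    lastCoord n (t • x) = t * lastCoord n x := by
  unfold lastCoord; split_ifs <;> simp

lemma abs_lastCoord_le (n : ℕ) (x : EuclideanSpace ℝ (Fin n)) :
    |lastCoord n x| ≤ ‖x‖ := by
  unfold lastCoord; split_ifs
  · exact PiLp.norm_apply_le x _
  · simp

@[fun_prop]
lemma continuous_lastCoord (n : ℕ) : Continuous (lastCoord n) := by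
  unfold lastCoord; split_ifs <;> fun_prop

lemma isOpen_upperHalf (n : ℕ) : IsOpen (upperHalf n) :=
  isOpen_lt continuous_const (continuous_lastCoord n)

/-- There is a vertical unit vector. -/
lemma exists_vertical {n : ℕ} (hn : 1 ≤ n) :
    ∃ e : EuclideanSpace ℝ (Fin n), ‖e‖ = 1 ∧ lastCoord n e = 1 := by
  refine ⟨EuclideanSpace.single ⟨n - 1, by omega⟩ 1, by simp, ?_⟩
  simp [lastCoord, show 0 < n by omega]

lemma log_one_add_div_le_hypDist {n : ℕ} {x y : EuclideanSpace ℝ (Fin n)}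
    (hx : x ∈ upperHalf n) (hy : y ∈ upperHalf n) :
    Real.log (1 + ‖x - y‖ / lastCoord n x) ≤ hypDist n x y := by
  have hx : 0 < lastCoord n x := hx
  have hy : 0 < lastCoord n y := hy
  set a := lastCoord n x
  set b := lastCoord n y
  set r := ‖x - y‖
  have hr : 0 ≤ r := norm_nonneg _
  have hb : b ≤ a + r := by
    have := (abs_le.1 (abs_lastCoord_le n (x - y))).1
    rw [lastCoord_sub] at this
    linarith
  have h1 : 0 < 1 + r / a := by positivity
  have hsinh : Real.sinh (Real.log (1 + r / a) / 2) ≤ r / (2 * √(a * b)) := by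
    have e1 : Real.exp (Real.log (1 + r / a) / 2) = √(1 + r / a) := by
      rw [Real.exp_half, Real.exp_log h1]
    rw [Real.sinh_eq, Real.exp_neg, e1]
    have hs : 0 < √(1 + r / a) := Real.sqrt_pos.2 h1
    have e2 : √(1 + r / a) - (√(1 + r / a))⁻¹ = (r / a) / √(1 + r / a) := by
      rw [eq_div_iff hs.ne', sub_mul, inv_mul_cancel₀ hs.ne', Real.mul_self_sqrt h1.le]
      ring
    have e3 : √(a * b) ≤ a * √(1 + r / a) := by
      rw [Real.sqrt_le_left (by positivity), mul_pow, Real.sq_sqrt h1.le]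
      have : a ^ 2 * (1 + r / a) = a * (a + r) := by field_simp
      rw [this]
      gcongr
    rw [e2]
    calc r / a / √(1 + r / a) / 2 = r / (2 * (a * √(1 + r / a))) := by field_simp
      _ ≤ r / (2 * √(a * b)) := by gcongr
  have := Real.arsinh_le_arsinh.2 hsinh
  rw [Real.arsinh_sinh] at this
  unfold hypDist
  linarith

/-- The image of a measure under a homothety, tested against a function. -/
lemma lintegral_homothety {E : Type*} [NormedAddCommGroup E] [NormedSpace ℝ E]
    [FiniteDimensional ℝ E] [MeasurableSpace E] [BorelSpace E] (μ : Measure E)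
    [μ.IsAddHaarMeasure] {t : ℝ} (ht : 0 < t) (a : E) {φ : E → ℝ≥0∞} (hφ : Measurable φ) :
    ENNReal.ofReal (t ^ Module.finrank ℝ E) * ∫⁻ z, φ (a + t • (z - a)) ∂μ = ∫⁻ w, φ w ∂μ := by
  have h1 : ∫⁻ z, φ (a + t • (z - a)) ∂μ = ∫⁻ z, φ (a + t • z) ∂μ := by
    rw [← lintegral_add_right_eq_self _ a]
    simp
  have h2 : ∫⁻ z, φ (a + z) ∂(Measure.map (t • ·) μ) = ∫⁻ z, φ (a + t • z) ∂μ :=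
    lintegral_map (by fun_prop) (by fun_prop)
  rw [h1, ← h2, Measure.map_addHaar_smul μ ht.ne', lintegral_smul_measure, smul_eq_mul,
    ← mul_assoc, ← ENNReal.ofReal_mul (by positivity), abs_of_pos (by positivity),
    mul_inv_cancel₀ (by positivity), ENNReal.ofReal_one, one_mul, lintegral_add_left_eq_self]

/-- The contributions of the homothetic copies of an annular set have bounded logarithmic
overlap. -/
lemma lintegral_homothety_inv_le {E : Type*} [NormedAddCommGroup E] [NormedSpace ℝ E]
    {h : ℝ} (hh : 0 < h) (a w : E) {B : Set E} (hB : ∀ z ∈ B, h ≤ ‖z - a‖ ∧ ‖z - a‖ ≤ 5 * h) :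
    ∫⁻ t in Ioo (0 : ℝ) 1, ENNReal.ofReal t⁻¹ * B.indicator 1 (a + t⁻¹ • (w - a)) ≤ 5 := by
  set r := ‖w - a‖ with hr
  have hr0 : 0 ≤ r := norm_nonneg _
  calc ∫⁻ t in Ioo (0 : ℝ) 1, ENNReal.ofReal t⁻¹ * B.indicator 1 (a + t⁻¹ • (w - a))
      ≤ ∫⁻ t in Ioo (0 : ℝ) 1,
          (Icc (r / (5 * h)) (r / h)).indicator (fun _ ↦ ENNReal.ofReal (5 * h / r)) t := by
        refine setLIntegral_mono' measurableSet_Ioo fun t ht ↦ ?_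
        by_cases hz : a + t⁻¹ • (w - a) ∈ B
        · have h1 : ‖a + t⁻¹ • (w - a) - a‖ = r / t := by
            rw [add_sub_cancel_left, norm_smul, Real.norm_of_nonneg (inv_nonneg.2 ht.1.le), ← hr]
            ring
          obtain ⟨h2, h3⟩ := hB _ hz
          rw [h1] at h2 h3
          rw [le_div_iff₀ ht.1] at h2
          rw [div_le_iff₀ ht.1] at h3
          have hrpos : 0 < r := lt_of_lt_of_le (mul_pos hh ht.1) h2
          have hmem : t ∈ Icc (r / (5 * h)) (r / h) := by
            constructor
            · rw [div_le_iff₀ (by positivity)]; linarith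
            · rw [le_div_iff₀ hh]; linarith
          rw [indicator_of_mem hz, indicator_of_mem hmem, Pi.one_apply, mul_one]
          refine ENNReal.ofReal_le_ofReal ?_
          rw [inv_le_comm₀ ht.1 (by positivity), inv_div]
          exact hmem.1
        · simp [hz]
    _ ≤ ∫⁻ t, (Icc (r / (5 * h)) (r / h)).indicator (fun _ ↦ ENNReal.ofReal (5 * h / r)) t :=
        setLIntegral_le_lintegral _ _
    _ = ENNReal.ofReal (5 * h / r) * ENNReal.ofReal (r / h - r / (5 * h)) := by
        rw [lintegral_indicator_const measurableSet_Icc, Real.volume_Icc]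
    _ = ENNReal.ofReal (5 * h / r * (r / h - r / (5 * h))) := by
        rw [ENNReal.ofReal_mul (by positivity)]
    _ ≤ ENNReal.ofReal 5 := by
        refine ENNReal.ofReal_le_ofReal ?_
        rcases hr0.eq_or_lt with h0 | h0
        · simp [← h0]
        · field_simp; norm_num
    _ = 5 := by simp

/-- The energy swept by the segments from `a` to a set at distance comparable to `h`. -/
lemma lintegral_lintegral_homothety_le {E : Type*} [NormedAddCommGroup E] [NormedSpace ℝ E]
    [FiniteDimensional ℝ E] [MeasurableSpace E] [BorelSpace E] (μ : Measure E)
    [μ.IsAddHaarMeasure] {h : ℝ} (hh : 0 < h) (a : E) {B : Set E} (hBm : MeasurableSet B)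
    (hB : ∀ z ∈ B, h ≤ ‖z - a‖ ∧ ‖z - a‖ ≤ 5 * h) {G : E → ℝ≥0∞} (hG : Measurable G) :
    ∫⁻ t in Ioo (0 : ℝ) 1, ∫⁻ z in B,
        ENNReal.ofReal (t ^ ((Module.finrank ℝ E : ℝ) - 1)) * G (a + t • (z - a)) ∂μ ≤
      5 * ∫⁻ w, G w ∂μ := by
  have hind : Measurable (B.indicator (1 : E → ℝ≥0∞)) := measurable_one.indicator hBm
  calc ∫⁻ t in Ioo (0 : ℝ) 1, ∫⁻ z in B,
        ENNReal.ofReal (t ^ ((Module.finrank ℝ E : ℝ) - 1)) * G (a + t • (z - a)) ∂μ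
      = ∫⁻ t in Ioo (0 : ℝ) 1, ∫⁻ w,
          (ENNReal.ofReal t⁻¹ * B.indicator 1 (a + t⁻¹ • (w - a))) * G w ∂μ := by
        refine setLIntegral_congr_fun measurableSet_Ioo fun t ht ↦ ?_
        have hpow : t ^ ((Module.finrank ℝ E : ℝ) - 1) = t⁻¹ * t ^ Module.finrank ℝ E := by
          rw [Real.rpow_sub ht.1, Real.rpow_natCast, Real.rpow_one, div_eq_inv_mul]
        have hm : Measurable fun w ↦ B.indicator (1 : E → ℝ≥0∞) (a + t⁻¹ • (w - a)) * G w :=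
          (hind.comp (by fun_prop)).mul hG
        simp only [mul_assoc]
        rw [lintegral_const_mul _ hm, lintegral_const_mul _ (by fun_prop),
          ← lintegral_homothety μ ht.1 a hm, hpow, ENNReal.ofReal_mul (inv_nonneg.2 ht.1.le),
          mul_assoc]
        congr 2
        rw [← lintegral_indicator hBm]
        refine lintegral_congr fun z ↦ ?_
        rw [add_sub_cancel_left, smul_smul, inv_mul_cancel₀ ht.1.ne', one_smul,
          add_sub_cancel]
        by_cases hz : z ∈ B <;> simp [hz]
    _ = ∫⁻ w, (∫⁻ t in Ioo (0 : ℝ) 1,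
          (ENNReal.ofReal t⁻¹ * B.indicator 1 (a + t⁻¹ • (w - a))) * G w) ∂μ := by
        refine lintegral_lintegral_swap (Measurable.aemeasurable ?_)
        exact ((by fun_prop : Measurable fun q : ℝ × E ↦ ENNReal.ofReal q.1⁻¹).mul
          (hind.comp (by fun_prop))).mul (hG.comp measurable_snd)
    _ ≤ ∫⁻ w, 5 * G w ∂μ := by
        refine lintegral_mono fun w ↦ ?_
        rw [lintegral_mul_const]
        · gcongr
          exact lintegral_homothety_inv_le hh a w hB
        · exact (by fun_prop : Measurable fun t : ℝ ↦ ENNReal.ofReal t⁻¹).mul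
            (hind.comp (by fun_prop))
    _ = 5 * ∫⁻ w, G w ∂μ := lintegral_const_mul _ hG

/-- The oscillation of a `C¹` function along a segment is controlled by its differential. -/
lemma enorm_sub_le_lintegral_fderiv_segment {E : Type*} [NormedAddCommGroup E]
    [NormedSpace ℝ E] {u : E → ℝ} {U : Set E} (hU : IsOpen U) (hu : ContDiffOn ℝ 1 u U)
    {a z : E} (hseg : ∀ t ∈ Icc (0 : ℝ) 1, a + t • (z - a) ∈ U) :
    ‖u z - u a‖ₑ ≤
      ‖z - a‖ₑ * ∫⁻ t in Ioo (0 : ℝ) 1, ‖fderiv ℝ u (a + t • (z - a))‖ₑ := by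
  have h1 : ContDiffOn ℝ 1 (fun t : ℝ ↦ u (a + t • (z - a))) (Icc 0 1) :=
    hu.comp (by fun_prop) hseg
  have h2 := enorm_sub_le_lintegral_deriv_of_contDiffOn_Icc h1 zero_le_one
  simp only [one_smul, zero_smul, add_zero, add_sub_cancel] at h2
  refine h2.trans ?_
  rw [← restrict_Ioo_eq_restrict_Icc, ← lintegral_const_mul' _ _ enorm_ne_top]
  refine setLIntegral_mono' measurableSet_Ioo fun t ht ↦ ?_
  have hd : HasFDerivAt u (fderiv ℝ u (a + t • (z - a))) (a + t • (z - a)) :=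
    ((hu.contDiffAt (hU.mem_nhds (hseg t (Ioo_subset_Icc_self ht)))).differentiableAt
      one_ne_zero).hasFDerivAt
  have hl : HasDerivAt (fun t : ℝ ↦ a + t • (z - a)) (z - a) t := by
    simpa using ((hasDerivAt_id t).smul_const (z - a)).const_add a
  have hc : HasDerivAt (fun t : ℝ ↦ u (a + t • (z - a)))
      (fderiv ℝ u (a + t • (z - a)) (z - a)) t := hd.comp_hasDerivAt t hl
  rw [hc.deriv, mul_comm]
  exact ContinuousLinearMap.le_opENorm _ _

/-- The mean oscillation of `u` around `a` over a set that lies above `a`, at height and distance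
comparable to `h`. -/
lemma setLIntegral_enorm_sub_le {n : ℕ} (hn : 1 ≤ n) {p : ℝ} (hnp : (n : ℝ) < p)
    {u : EuclideanSpace ℝ (Fin n) → ℝ} (hu : ContDiffOn ℝ 1 u (upperHalf n))
    {a : EuclideanSpace ℝ (Fin n)} (ha : a ∈ upperHalf n) {h : ℝ} (hh : 0 < h)
    {B : Set (EuclideanSpace ℝ (Fin n))} (hBm : MeasurableSet B)
    (hB : ∀ z ∈ B, h ≤ ‖z - a‖ ∧ ‖z - a‖ ≤ 5 * h)
    (hBv : ∀ z ∈ B, lastCoord n a + h ≤ lastCoord n z) :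
    ∫⁻ z in B, ‖u z - u a‖ₑ ≤
      ENNReal.ofReal (5 * h) * ((5 * energy n (p - n) p u) ^ (1 / p) *
        (volume B * ENNReal.ofReal (h ^ (-((p - n) / (p - 1))) *
          (Real.log (1 + h / lastCoord n a) +
            Real.log (1 + h / lastCoord n a) ^ ((p - n) / (p - 1)) / ((p - n) / (p - 1))))) ^
          (1 / (p / (p - 1)))) := by
  have hn1 : (1 : ℝ) ≤ n := by exact_mod_cast hn
  have hp1 : 1 < p := by linarith
  have hp0 : 0 < p := by linarith
  have hpn : 0 < p - n := by linarith
  have hq0 : 0 < p / (p - 1) := div_pos hp0 (by linarith)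
  have hpq : p.HolderConjugate (p / (p - 1)) := Real.HolderConjugate.conjExponent hp1
  set α := (p - n) / (p - 1) with hα
  have hα0 : 0 < α := div_pos hpn (by linarith)
  have hα1 : α ≤ 1 := (div_le_one (by linarith)).2 (by linarith)
  have ha0 : 0 < lastCoord n a := ha
  have hheight : ∀ z ∈ B, ∀ t ∈ Icc (0 : ℝ) 1,
      lastCoord n a + t * h ≤ lastCoord n (a + t • (z - a)) := by
    intro z hz t ht
    rw [lastCoord_add, lastCoord_smul, lastCoord_sub]
    have := hBv z hz
    gcongr
    · exact ht.1
    · linarith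
  have hupper : ∀ z ∈ B, ∀ t ∈ Icc (0 : ℝ) 1, a + t • (z - a) ∈ upperHalf n := fun z hz t ht ↦
    lt_of_lt_of_le (by have := mul_nonneg ht.1 hh.le; linarith) (hheight z hz t ht)
  set ν := (volume.restrict (Ioo (0 : ℝ) 1)).prod (volume.restrict B) with hν
  have hνS : ν = (volume.prod volume).restrict (Ioo (0 : ℝ) 1 ×ˢ B) := Measure.prod_restrict _ _
  have hSm : MeasurableSet (Ioo (0 : ℝ) 1 ×ˢ B) := measurableSet_Ioo.prod hBm
  have hlc : Measurable (lastCoord n) := (continuous_lastCoord n).measurable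
  have hDu : Measurable (fderiv ℝ u) := measurable_fderiv ℝ u
  let w : ℝ × EuclideanSpace ℝ (Fin n) → EuclideanSpace ℝ (Fin n) := fun q ↦ a + q.1 • (q.2 - a)
  have hw : Measurable w := by fun_prop
  let f : ℝ × EuclideanSpace ℝ (Fin n) → ℝ≥0∞ := fun q ↦
    ENNReal.ofReal (‖fderiv ℝ u (w q)‖ *
      (lastCoord n (w q) ^ ((p - n) / p) * q.1 ^ (((n : ℝ) - 1) / p)))
  let g : ℝ × EuclideanSpace ℝ (Fin n) → ℝ≥0∞ := fun q ↦
    ENNReal.ofReal (lastCoord n (w q) ^ (-((p - n) / p)) * q.1 ^ (-(((n : ℝ) - 1) / p)))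
  have hf : Measurable f := by
    refine ENNReal.measurable_ofReal.comp ((hDu.comp hw).norm.mul ?_)
    exact ((hlc.comp hw).pow_const _).mul (measurable_fst.pow_const _)
  have hg : Measurable g := by
    refine ENNReal.measurable_ofReal.comp ?_
    exact ((hlc.comp hw).pow_const _).mul (measurable_fst.pow_const _)
  have hfg : ∫⁻ q, ‖fderiv ℝ u (w q)‖ₑ ∂ν = ∫⁻ q, (f * g) q ∂ν := by
    rw [hνS]
    refine setLIntegral_congr_fun hSm fun q hq ↦ ?_
    have h1 : 0 < lastCoord n (w q) := hupper q.2 hq.2 q.1 (Ioo_subset_Icc_self hq.1)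
    have h2 : 0 < q.1 := hq.1.1
    simp only [f, g, Pi.mul_apply]
    rw [← ENNReal.ofReal_mul (by positivity), Real.rpow_neg h1.le, Real.rpow_neg h2.le,
      ← ofReal_norm]
    congr 1
    field_simp
  let G : EuclideanSpace ℝ (Fin n) → ℝ≥0∞ := (upperHalf n).indicator fun z ↦
    ENNReal.ofReal (‖fderiv ℝ u z‖ ^ p * lastCoord n z ^ (p - n))
  have hG : Measurable G := by
    refine Measurable.indicator ?_ (isOpen_upperHalf n).measurableSet
    exact ENNReal.measurable_ofReal.comp ((hDu.norm.pow_const _).mul (hlc.pow_const _))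
  have hfp : ∫⁻ q, f q ^ p ∂ν ≤ 5 * energy n (p - n) p u := by
    rw [hν, lintegral_prod _ (hf.pow_const _).aemeasurable]
    have hE : energy n (p - n) p u = ∫⁻ z, G z :=
      (lintegral_indicator (isOpen_upperHalf n).measurableSet _).symm
    have key := lintegral_lintegral_homothety_le volume hh a hBm hB hG
    rw [finrank_euclideanSpace_fin] at key
    rw [hE]
    refine le_trans (setLIntegral_mono' measurableSet_Ioo fun t ht ↦
      setLIntegral_mono' hBm fun z hz ↦ ?_) key
    have h0 := hupper z hz t (Ioo_subset_Icc_self ht)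
    have h1 : 0 < lastCoord n (a + t • (z - a)) := h0
    have h2 : 0 < t := ht.1
    simp only [G, f, w]
    rw [indicator_of_mem h0, ← ENNReal.ofReal_mul (by positivity),
      ENNReal.ofReal_rpow_of_nonneg (by positivity) hp0.le,
      Real.mul_rpow (by positivity) (by positivity), Real.mul_rpow (by positivity) (by positivity),
      ← Real.rpow_mul h1.le, ← Real.rpow_mul h2.le, div_mul_cancel₀ _ hp0.ne',
      div_mul_cancel₀ _ hp0.ne']
    refine ENNReal.ofReal_le_ofReal (le_of_eq ?_)
    ring
  have hgq : ∫⁻ q, g q ^ (p / (p - 1)) ∂ν ≤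
      volume B * ENNReal.ofReal (h ^ (-α) * (Real.log (1 + h / lastCoord n a) +
        Real.log (1 + h / lastCoord n a) ^ α / α)) := by
    rw [hν, lintegral_prod _ (hg.pow_const _).aemeasurable]
    calc ∫⁻ t in Ioo (0 : ℝ) 1, ∫⁻ z in B, g (t, z) ^ (p / (p - 1))
        ≤ ∫⁻ t in Ioo (0 : ℝ) 1, ∫⁻ _ in B,
            ENNReal.ofReal ((lastCoord n a + t * h) ^ (-α) * t ^ (α - 1)) := by
          refine setLIntegral_mono' measurableSet_Ioo fun t ht ↦
            setLIntegral_mono' hBm fun z hz ↦ ?_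
          have h1 : 0 < lastCoord n (a + t • (z - a)) := hupper z hz t (Ioo_subset_Icc_self ht)
          have h2 : 0 < t := ht.1
          have h3 := hheight z hz t (Ioo_subset_Icc_self ht)
          have hp1' : p - 1 ≠ 0 := by linarith
          have e1 : -((p - n) / p) * (p / (p - 1)) = -α := by
            rw [hα]; field_simp
          have e2 : -(((n : ℝ) - 1) / p) * (p / (p - 1)) = α - 1 := by
            rw [hα]; field_simp; ring
          simp only [g, w]
          rw [ENNReal.ofReal_rpow_of_nonneg (by positivity) hq0.le,
            Real.mul_rpow (by positivity) (by positivity), ← Real.rpow_mul h1.le,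
            ← Real.rpow_mul h2.le, e1, e2]
          refine ENNReal.ofReal_le_ofReal ?_
          gcongr ?_ * _
          exact Real.rpow_le_rpow_of_nonpos (by positivity) h3 (by linarith)
      _ = volume B * ∫⁻ t in Ioo (0 : ℝ) 1,
            ENNReal.ofReal ((lastCoord n a + t * h) ^ (-α) * t ^ (α - 1)) := by
          simp only [setLIntegral_const]
          rw [lintegral_mul_const _ (by fun_prop), mul_comm]
      _ ≤ _ := by
          gcongr
          exact lintegral_rpow_weight_le hα0 hα1 ha0 hh
  calc ∫⁻ z in B, ‖u z - u a‖ₑ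
      ≤ ∫⁻ z in B, ENNReal.ofReal (5 * h) * ∫⁻ t in Ioo (0 : ℝ) 1, ‖fderiv ℝ u (w (t, z))‖ₑ := by
        refine setLIntegral_mono' hBm fun z hz ↦ ?_
        refine (enorm_sub_le_lintegral_fderiv_segment (isOpen_upperHalf n) hu
          (hupper z hz)).trans ?_
        gcongr
        rw [← ofReal_norm]
        exact ENNReal.ofReal_le_ofReal (hB z hz).2
    _ = ENNReal.ofReal (5 * h) * ∫⁻ q, ‖fderiv ℝ u (w q)‖ₑ ∂ν := by
        rw [lintegral_const_mul' _ _ ENNReal.ofReal_ne_top, hν,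
          lintegral_prod_symm (fun q ↦ ‖fderiv ℝ u (w q)‖ₑ) (hDu.comp hw).enorm.aemeasurable]
    _ ≤ ENNReal.ofReal (5 * h) * ((∫⁻ q, f q ^ p ∂ν) ^ (1 / p) *
          (∫⁻ q, g q ^ (p / (p - 1)) ∂ν) ^ (1 / (p / (p - 1)))) := by
        rw [hfg]
        gcongr
        exact ENNReal.lintegral_mul_le_Lp_mul_Lq ν hpq hf.aemeasurable hg.aemeasurable
    _ ≤ _ := by gcongr

/-- Morrey–Sobolev inequality on the hyperbolic space. -/
theorem hyperbolic_morrey_sobolev (n : ℕ) (hn : 1 ≤ n) (p : ℝ) (hnp : (n : ℝ) < p) :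
    ∃ C : ℝ, 0 < C ∧
      ∀ u : EuclideanSpace ℝ (Fin n) → ℝ,
        ContDiffOn ℝ 1 u (upperHalf n) →
        energy n (p - n) p u < ⊤ →
        ∀ x ∈ upperHalf n, ∀ y ∈ upperHalf n,
          |u x - u y| ≤
            C * max (hypDist n x y ^ (1 - (n : ℝ) / p)) (hypDist n x y ^ (1 - 1 / p)) *
              (energy n (p - n) p u).toReal ^ (1 / p) := by
  have hn1 : (1 : ℝ) ≤ n := by exact_mod_cast hn
  have hp1 : 1 < p := by linarith
  have hp0 : 0 < p := by linarith
  have hp1' : p - 1 ≠ 0 := by linarith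
  set V := volume (Metric.ball (0 : EuclideanSpace ℝ (Fin n)) 1) with hV
  set ω := V.toReal with hω
  have hVtop : V ≠ ⊤ := Metric.isBounded_ball.measure_lt_top.ne
  have hω0 : 0 < ω := ENNReal.toReal_pos (Metric.measure_ball_pos _ _ one_pos).ne' hVtop
  set α := (p - n) / (p - 1) with hα
  have hα0 : 0 < α := div_pos (by linarith) (by linarith)
  set s := 1 / (p / (p - 1)) with hs
  have hs0 : 0 ≤ s := by
    have : 0 ≤ p - 1 := by linarith
    positivity
  have hs1 : s = 1 - 1 / p := by rw [hs]; field_simp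
  set K := ω * (1 + 1 / α) with hK
  have hK0 : 0 < K := by positivity
  refine ⟨10 * 5 ^ (1 / p) * K ^ s / ω, by positivity, fun u hu hE x hx y hy ↦ ?_⟩
  set e := (energy n (p - n) p u).toReal with he
  have he0 : 0 ≤ e := ENNReal.toReal_nonneg
  set d := hypDist n x y with hd
  have hd0 : 0 ≤ d := by
    rw [hd]; unfold hypDist
    have : 0 ≤ Real.arsinh (‖x - y‖ / (2 * √(lastCoord n x * lastCoord n y))) :=
      Real.arsinh_nonneg_iff.2 (by positivity)
    linarith
  have hmax0 : 0 ≤ max (d ^ (1 - (n : ℝ) / p)) (d ^ (1 - 1 / p)) :=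
    le_max_of_le_left (Real.rpow_nonneg hd0 _)
  rcases eq_or_ne x y with rfl | hxy
  · simp only [sub_self, abs_zero]
    positivity
  set h := ‖x - y‖ with hh
  have hh0 : 0 < h := norm_sub_pos_iff.2 hxy
  obtain ⟨v, hv1, hv2⟩ := exists_vertical hn
  set B := Metric.ball (x + (3 * h) • v) h with hB
  have hvol : volume B = ENNReal.ofReal (h ^ n * ω) := by
    rw [hB, Measure.addHaar_ball_of_pos _ _ hh0, finrank_euclideanSpace_fin,
      ENNReal.ofReal_mul (by positivity), hω, ENNReal.ofReal_toReal hVtop]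
  have hyx : ‖y - x‖ = h := norm_sub_rev y x
  have hlyx : lastCoord n y - lastCoord n x ≤ h := by
    have := (abs_le.1 (abs_lastCoord_le n (y - x))).2
    rwa [lastCoord_sub, hyx] at this
  have hBz : ∀ z ∈ B, 2 * h ≤ lastCoord n z - lastCoord n x ∧ ‖z - x‖ ≤ 4 * h := by
    intro z hz
    have hz' : ‖z - (x + (3 * h) • v)‖ < h := mem_ball_iff_norm.1 hz
    constructor
    · have := (abs_le.1 (abs_lastCoord_le n (z - (x + (3 * h) • v)))).1
      rw [lastCoord_sub, lastCoord_add, lastCoord_smul, hv2] at this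
      linarith
    · have h1 : z - x = (z - (x + (3 * h) • v)) + (3 * h) • v := by abel
      have h2 : ‖(3 * h) • v‖ = 3 * h := by
        rw [norm_smul, hv1, mul_one, Real.norm_of_nonneg (by positivity)]
      have := norm_add_le (z - (x + (3 * h) • v)) ((3 * h) • v)
      rw [← h1, h2] at this
      linarith
  set M := max d (d ^ α) with hM
  have hM0 : 0 ≤ M := le_max_of_le_left hd0
  set R := 5 * h * ((5 * e) ^ (1 / p) * (h ^ n * ω * (h ^ (-α) * ((1 + 1 / α) * M))) ^ s) with hR
  have hR0 : 0 ≤ R := by positivity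
  have hmean : ∀ a ∈ upperHalf n, Real.log (1 + h / lastCoord n a) ≤ d →
      (∀ z ∈ B, lastCoord n a + h ≤ lastCoord n z ∧ ‖z - a‖ ≤ 5 * h) →
      ∫⁻ z in B, ‖u z - u a‖ₑ ≤ ENNReal.ofReal R := by
    intro a ha hlog hBa
    have ha0 : 0 < lastCoord n a := ha
    have hlog0 : 0 ≤ Real.log (1 + h / lastCoord n a) :=
      Real.log_nonneg (by have : 0 ≤ h / lastCoord n a := by positivity
                          linarith)
    refine (setLIntegral_enorm_sub_le hn hnp hu ha hh0 measurableSet_ball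
      (fun z hz ↦ ⟨?_, (hBa z hz).2⟩) (fun z hz ↦ (hBa z hz).1)).trans ?_
    · have := (abs_le.1 (abs_lastCoord_le n (z - a))).2
      rw [lastCoord_sub] at this
      linarith [(hBa z hz).1]
    · have hE5 : 5 * energy n (p - n) p u = ENNReal.ofReal (5 * e) := by
        rw [ENNReal.ofReal_mul (by norm_num), he, ENNReal.ofReal_toReal hE.ne]
        simp
      rw [← hB, hvol, hE5, ← ENNReal.ofReal_mul (by positivity),
        ENNReal.ofReal_rpow_of_nonneg (by positivity) (by positivity),
        ENNReal.ofReal_rpow_of_nonneg (by positivity) hs0,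
        ← ENNReal.ofReal_mul (by positivity), ← ENNReal.ofReal_mul (by positivity)]
      refine ENNReal.ofReal_le_ofReal ?_
      rw [hR]
      gcongr
      have h1 : Real.log (1 + h / lastCoord n a) ≤ M := hlog.trans (le_max_left _ _)
      have h2 : Real.log (1 + h / lastCoord n a) ^ α ≤ M :=
        (Real.rpow_le_rpow hlog0 hlog hα0.le).trans (le_max_right _ _)
      calc _ ≤ M + M / α := by gcongr
        _ = (1 + 1 / α) * M := by ring
  have hmx : ∫⁻ z in B, ‖u z - u x‖ₑ ≤ ENNReal.ofReal R := by
    refine hmean x hx (log_one_add_div_le_hypDist hx hy) fun z hz ↦ ?_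
    obtain ⟨h1, h2⟩ := hBz z hz
    constructor <;> linarith
  have hmy : ∫⁻ z in B, ‖u z - u y‖ₑ ≤ ENNReal.ofReal R := by
    have hsymm : hypDist n y x = d := by
      rw [hd]; unfold hypDist; rw [norm_sub_rev, mul_comm (lastCoord n y)]
    refine hmean y hy ?_ fun z hz ↦ ?_
    · have := log_one_add_div_le_hypDist hy hx
      rwa [hsymm, hyx] at this
    · obtain ⟨h1, h2⟩ := hBz z hz
      refine ⟨by linarith, ?_⟩
      have := norm_sub_le_norm_sub_add_norm_sub z x y
      linarith
  have hBU : B ⊆ upperHalf n := fun z hz ↦ by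
    have hx0 : 0 < lastCoord n x := hx
    have : 0 < lastCoord n z := by linarith [(hBz z hz).1]
    exact this
  have hmeas : AEMeasurable (fun z ↦ ‖u z - u x‖ₑ) (volume.restrict B) :=
    (((hu.continuousOn.mono hBU).sub continuousOn_const).enorm).aemeasurable measurableSet_ball
  have hsum : ENNReal.ofReal (|u x - u y| * (h ^ n * ω)) ≤ ENNReal.ofReal (R + R) := by
    calc ENNReal.ofReal (|u x - u y| * (h ^ n * ω)) = ∫⁻ _ in B, ‖u x - u y‖ₑ := by
          rw [setLIntegral_const, hvol, ENNReal.ofReal_mul (abs_nonneg _),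
            ← Real.enorm_eq_ofReal_abs]
      _ ≤ ∫⁻ z in B, (‖u z - u x‖ₑ + ‖u z - u y‖ₑ) := by
          refine lintegral_mono fun z ↦ ?_
          have : u x - u y = (u z - u y) - (u z - u x) := by ring
          rw [this, add_comm]
          exact enorm_sub_le
      _ ≤ ENNReal.ofReal R + ENNReal.ofReal R := by
          rw [lintegral_add_left' hmeas]
          exact add_le_add hmx hmy
      _ = ENNReal.ofReal (R + R) := (ENNReal.ofReal_add hR0 hR0).symm
  have hreal : |u x - u y| * (h ^ n * ω) ≤ R + R :=
    (ENNReal.ofReal_le_ofReal_iff (by positivity)).1 hsum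
  have hpow : h * (h ^ n * h ^ (-α)) ^ s = h ^ n := by
    rw [← Real.rpow_natCast, ← Real.rpow_add hh0, ← Real.rpow_mul hh0.le]
    nth_rewrite 1 [← Real.rpow_one h]
    rw [← Real.rpow_add hh0]
    congr 1
    rw [hα, hs]
    field_simp
    ring
  have hRe : R + R = 10 * 5 ^ (1 / p) * K ^ s * M ^ s * e ^ (1 / p) * h ^ n := by
    have h1 : h ^ n * ω * (h ^ (-α) * ((1 + 1 / α) * M)) = (h ^ n * h ^ (-α)) * (K * M) := by
      rw [hK]; ring
    rw [hR, h1, Real.mul_rpow (by norm_num) he0,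
      Real.mul_rpow (x := h ^ n * h ^ (-α)) (by positivity) (by positivity),
      Real.mul_rpow hK0.le hM0]
    linear_combination 10 * 5 ^ (1 / p) * K ^ s * M ^ s * e ^ (1 / p) * hpow
  have hMs : M ^ s ≤ max (d ^ (1 - (n : ℝ) / p)) (d ^ (1 - 1 / p)) := by
    rcases max_choice d (d ^ α) with h1 | h1
    · rw [hM, h1, hs1]
      exact le_max_right _ _
    · have h2 : α * s = 1 - n / p := by
        rw [hα, hs]; field_simp
      rw [hM, h1, ← Real.rpow_mul hd0, h2]
      exact le_max_left _ _
  have hfin : |u x - u y| ≤ 10 * 5 ^ (1 / p) * K ^ s / ω * M ^ s * e ^ (1 / p) := by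
    have h1 : 0 < h ^ n * ω := by positivity
    refine le_of_mul_le_mul_right (hreal.trans_eq ?_) h1
    rw [hRe]
    field_simp
  refine hfin.trans ?_
  gcongr
end
end
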